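/- Let D̄ be a closed disc in ℂ with centre 0, let m be a positive integer, and let R : D̄ → ℂ be continuous and satisfy |R(z) − R(ζ)| < |z^m − ζ^m| for all z, ζ ∈ D̄ with z^m ≠ ζ^m. Define F(z) := z̄^m + R(z) for z ∈ D̄. Then Graph_{D̄}(F) is polynomially convex. -/

import Mathlib

open Complex Metric

noncomputable def pEval (x : ℂ × ℂ) (p : MvPolynomial (Fin 2) ℂ) : ℂ :=
  MvPolynomial.eval ![x.1, x.2] p

/-- The polynomially convex hull of a set in `ℂ²`. -/
noncomputable def polyHull (X : Set (ℂ × ℂ)) : Set (ℂ × ℂ) :=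
  {x | ∀ p : MvPolynomial (Fin 2) ℂ, ‖pEval x p‖ ≤ ⨆ y ∈ X, ‖pEval y p‖}

def IsPolyConvex (X : Set (ℂ × ℂ)) : Prop := polyHull X = X

def graphOn (S : Set ℂ) (F : ℂ → ℂ) : Set (ℂ × ℂ) := {q | q.1 ∈ S ∧ q.2 = F q.1}

lemma continuous_pEval (p : MvPolynomial (Fin 2) ℂ) : Continuous fun x => pEval x p := by
  unfold pEval
  exact p.continuous_eval.comp
    (continuous_pi fun i => by fin_cases i <;> simp <;> fun_prop)

lemma norm_pEval_le_of_mem_polyHull {X : Set (ℂ × ℂ)} {x : ℂ × ℂ} (hx : x ∈ polyHull X)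
    (p : MvPolynomial (Fin 2) ℂ) {c : ℝ} (hc : 0 ≤ c) (h : ∀ y ∈ X, ‖pEval y p‖ ≤ c) :
    ‖pEval x p‖ ≤ c :=
  (hx p).trans (Real.iSup_le (fun y => Real.iSup_le (h y) hc) hc)

lemma subset_polyHull {X : Set (ℂ × ℂ)} (hX : IsCompact X) : X ⊆ polyHull X := by
  intro x hx p
  obtain ⟨c, hc⟩ := hX.exists_bound_of_continuousOn (continuous_pEval p).continuousOn
  have hc0 : 0 ≤ c := (norm_nonneg _).trans (hc x hx)
  have hb : BddAbove (Set.range fun y => ⨆ _ : y ∈ X, ‖pEval y p‖) := by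
    refine ⟨c, ?_⟩
    rintro _ ⟨y, rfl⟩
    exact Real.iSup_le (hc y) hc0
  refine le_trans ?_ (le_ciSup hb x)
  simp [hx]

/-- If `z` lies in the closed right half plane, then `(1 - z / n) ^ (n ^ 2)` is almost as small
as `exp (-n z)`. -/
lemma norm_one_sub_div_pow_le {z : ℂ} {M : ℝ} (hz : ‖z‖ ≤ M) {n : ℕ} (hn : 0 < n) :
    ‖(1 - z / n) ^ (n ^ 2)‖ ≤ Real.exp (-(n * z.re) + M ^ 2 / 2) := by
  have hn' : (0 : ℝ) < n := by exact_mod_cast hn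
  have hsq : ‖1 - z / n‖ ^ 2 ≤ Real.exp (-(2 * z.re / n) + M ^ 2 / n ^ 2) := by
    have h1 : ‖1 - z / n‖ ^ 2 = 1 - 2 * z.re / n + ‖z‖ ^ 2 / n ^ 2 := by
      rw [← Complex.normSq_eq_norm_sq, ← Complex.normSq_eq_norm_sq, Complex.normSq_sub]
      simp [Complex.normSq_apply]
      field_simp
      ring
    have h2 : ‖z‖ ^ 2 / n ^ 2 ≤ M ^ 2 / n ^ 2 := by gcongr
    have h3 := Real.add_one_le_exp (-(2 * z.re / n) + M ^ 2 / n ^ 2)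
    linarith
  refine le_of_sq_le_sq ?_ (Real.exp_pos _).le
  calc ‖(1 - z / n) ^ (n ^ 2)‖ ^ 2 = (‖1 - z / n‖ ^ 2) ^ (n ^ 2) := by
        rw [norm_pow, ← pow_mul, ← pow_mul, mul_comm]
    _ ≤ Real.exp (-(2 * z.re / n) + M ^ 2 / n ^ 2) ^ (n ^ 2) := by gcongr
    _ = Real.exp (-(n * z.re) + M ^ 2 / 2) ^ 2 := by
        rw [← Real.exp_nat_mul, ← Real.exp_nat_mul]
        congr 1
        push_cast
        field_simp

/-- A point of the hull at which `p` vanishes is a zero of `q`, as soon as `p` maps the compact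
set `X` into the open right half plane off the zeros of `q`. -/
lemma pEval_eq_zero_of_mem_polyHull {X : Set (ℂ × ℂ)} (hX : IsCompact X) {x : ℂ × ℂ}
    (hx : x ∈ polyHull X) (p q : MvPolynomial (Fin 2) ℂ) (hpx : pEval x p = 0)
    (hp : ∀ y ∈ X, 0 ≤ (pEval y p).re) (hpq : ∀ y ∈ X, pEval y q ≠ 0 → 0 < (pEval y p).re) :
    pEval x q = 0 := by
  by_contra hne
  set ε := ‖pEval x q‖ with hε
  have hε0 : 0 < ε := norm_pos_iff.2 hne
  obtain ⟨M, hM⟩ := hX.exists_bound_of_continuousOn (continuous_pEval p).continuousOn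
  obtain ⟨C, hC⟩ := hX.exists_bound_of_continuousOn (continuous_pEval q).continuousOn
  set E := Real.exp (M ^ 2 / 2)
  have hE : 0 < E := Real.exp_pos _
  set η := ε / 2 / E
  have hη : 0 < η := by positivity
  obtain ⟨δ, hδ0, hδ⟩ : ∃ δ > 0, ∀ y ∈ X, η ≤ ‖pEval y q‖ → δ ≤ (pEval y p).re := by
    have hK : IsCompact (X ∩ {y | η ≤ ‖pEval y q‖}) :=
      hX.inter_right (isClosed_le continuous_const (continuous_pEval q).norm)
    rcases (X ∩ {y | η ≤ ‖pEval y q‖}).eq_empty_or_nonempty with h | h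
    · exact ⟨1, one_pos, fun y hy hy' => absurd (h ▸ ⟨hy, hy'⟩ : y ∈ (∅ : Set _)) id⟩
    · obtain ⟨y, hy, hmin⟩ := hK.exists_isMinOn h
        (Complex.continuous_re.comp (continuous_pEval p)).continuousOn
      exact ⟨_, hpq y hy.1 (norm_pos_iff.1 (hη.trans_le hy.2)), fun z hz hz' => hmin ⟨hz, hz'⟩⟩
  have hlim : Filter.Tendsto (fun n : ℕ => C * (Real.exp (-(n * δ)) * E)) Filter.atTop
      (nhds (C * (0 * E))) :=
    ((Real.tendsto_exp_neg_atTop_nhds_zero.comp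
      (tendsto_natCast_atTop_atTop.atTop_mul_const hδ0)).mul_const E).const_mul C
  rw [zero_mul, mul_zero] at hlim
  obtain ⟨n, hn, hn0⟩ := ((hlim.eventually_lt_const (half_pos hε0)).and
    (Filter.eventually_gt_atTop 0)).exists
  have heval : ∀ y, pEval y (q * (1 - MvPolynomial.C ((n : ℂ)⁻¹) * p) ^ (n ^ 2)) =
      pEval y q * (1 - pEval y p / n) ^ (n ^ 2) := by
    intro y
    simp [pEval, div_eq_inv_mul]
  have key := norm_pEval_le_of_mem_polyHull hx
    (q * (1 - MvPolynomial.C ((n : ℂ)⁻¹) * p) ^ (n ^ 2)) (half_pos hε0).le ?_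
  · rw [heval, hpx] at key
    simp only [zero_div, sub_zero, one_pow, mul_one] at key
    linarith
  intro y hy
  rw [heval, norm_mul]
  have hb := norm_one_sub_div_pow_le (hM y hy) hn0
  rw [Real.exp_add] at hb
  rcases le_total η ‖pEval y q‖ with h | h
  · refine le_trans ?_ hn.le
    have hCy := hC y hy
    have hδy := hδ y hy h
    have hC0 : 0 ≤ C := (norm_nonneg _).trans hCy
    refine mul_le_mul hCy (hb.trans ?_) (norm_nonneg _) hC0
    gcongr
  · have h1 : Real.exp (-(n * (pEval y p).re)) ≤ 1 :=
      Real.exp_le_one_iff.2 (neg_nonpos.2 (mul_nonneg n.cast_nonneg (hp y hy)))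
    calc _ ≤ η * (1 * E) := by
          refine mul_le_mul h (hb.trans ?_) (norm_nonneg _) hη.le
          gcongr
      _ = ε / 2 := by rw [one_mul]; exact div_mul_cancel₀ _ hE.ne'

lemma isCompact_graphOn {S : Set ℂ} (hS : IsCompact S) {F : ℂ → ℂ} (hF : ContinuousOn F S) :
    IsCompact (graphOn S F) := by
  convert hS.image_of_continuousOn (continuousOn_id.prodMk hF)
  ext ⟨a, b⟩
  simp only [graphOn, Set.mem_ofPred_eq, Set.mem_image, id, Prod.mk.injEq]
  constructor
  · rintro ⟨h, rfl⟩
    exact ⟨a, h, rfl, rfl⟩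
  · rintro ⟨z, h, rfl, rfl⟩
    exact ⟨h, rfl⟩

lemma eq_of_pow_eq_of_norm_sub_lt {r : ℝ} {m : ℕ} (hm : 0 < m) {R : ℂ → ℂ}
    (hRc : ContinuousOn R (closedBall 0 r))
    (hR : ∀ z ∈ closedBall (0 : ℂ) r, ∀ ζ ∈ closedBall (0 : ℂ) r,
      z ^ m ≠ ζ ^ m → ‖R z - R ζ‖ < ‖z ^ m - ζ ^ m‖)
    {z ζ : ℂ} (hz : z ∈ closedBall (0 : ℂ) r) (hζ : ζ ∈ closedBall (0 : ℂ) r)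
    (h : z ^ m = ζ ^ m) : R z = R ζ := by
  rcases eq_or_ne z 0 with rfl | hz0
  · rw [zero_pow hm.ne'] at h
    rw [eq_zero_of_pow_eq_zero h.symm]
  have hmem : ∀ t ∈ Set.Ioo (0 : ℝ) 1, (t : ℂ) * z ∈ closedBall (0 : ℂ) r := by
    intro t ht
    rw [mem_closedBall_zero_iff] at hz ⊢
    rw [norm_mul, Complex.norm_real, Real.norm_of_nonneg ht.1.le]
    exact (mul_le_of_le_one_left (norm_nonneg _) ht.2.le).trans hz
  have hev : ∀ᶠ t : ℝ in nhdsWithin 1 (Set.Iio 1), t ∈ Set.Ioo (0 : ℝ) 1 :=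
    Ioo_mem_nhdsLT one_pos
  have ht : Filter.Tendsto (fun t : ℝ => (t : ℂ) * z) (nhdsWithin 1 (Set.Iio 1)) (nhds z) := by
    have : Continuous fun t : ℝ => (t : ℂ) * z := by fun_prop
    simpa using (this.tendsto 1).mono_left nhdsWithin_le_nhds
  have hRt := (hRc z hz).tendsto.comp
    (tendsto_nhdsWithin_iff.2 ⟨ht, hev.mono hmem⟩)
  have hle : ‖R z - R ζ‖ ≤ ‖z ^ m - ζ ^ m‖ := by
    refine le_of_tendsto_of_tendsto (hRt.sub_const (R ζ)).norm
      ((ht.pow m).sub_const (ζ ^ m)).norm ?_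
    filter_upwards [hev] with t ht
    refine (hR _ (hmem t ht) ζ hζ ?_).le
    rw [← h, mul_pow]
    intro h1
    have h2 : (t : ℂ) ^ m = 1 := mul_right_cancel₀ (pow_ne_zero m hz0) (h1.trans (one_mul _).symm)
    have h3 : t ^ m = 1 := by exact_mod_cast h2
    exact (pow_lt_one₀ ht.1.le ht.2 hm.ne').ne h3
  rw [h, sub_self, norm_zero] at hle
  exact sub_eq_zero.1 (norm_le_zero_iff.1 hle)

lemma re_mul_conj_add_pos {d s : ℂ} (h : ‖s‖ < ‖d‖) : 0 < (d * ((starRingEnd ℂ) d + s)).re := by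
  have h1 : (d * ((starRingEnd ℂ) d + s)).re = ‖d‖ ^ 2 + (d * s).re := by
    rw [mul_add, Complex.add_re, Complex.mul_conj, Complex.ofReal_re, Complex.normSq_eq_norm_sq]
  have h2 := (abs_le.1 (Complex.abs_re_le_norm (d * s))).1
  rw [norm_mul] at h2
  nlinarith [norm_nonneg s]

/-- Theorem 1.6 (first part): the graph of `z̄^m + R(z)` is polynomially convex. -/
theorem wermerII_polyConvex (r : ℝ) (hr : 0 < r) (m : ℕ) (hm : 0 < m)
    (R : ℂ → ℂ) (hRc : ContinuousOn R (closedBall 0 r))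
    (hR : ∀ z ∈ closedBall (0 : ℂ) r, ∀ ζ ∈ closedBall (0 : ℂ) r,
      z ^ m ≠ ζ ^ m → ‖R z - R ζ‖ < ‖z ^ m - ζ ^ m‖) :
    IsPolyConvex
      (graphOn (closedBall 0 r) (fun z => (starRingEnd ℂ) z ^ m + R z)) := by
  set F : ℂ → ℂ := fun z => (starRingEnd ℂ) z ^ m + R z with hF
  have hFc : ContinuousOn F (closedBall 0 r) :=
    (Complex.continuous_conj.pow m).continuousOn.add hRc
  have hX := isCompact_graphOn (isCompact_closedBall (0 : ℂ) r) hFc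
  refine Set.Subset.antisymm ?_ (subset_polyHull hX)
  rintro ⟨a, b⟩ hx
  have ha : a ∈ closedBall (0 : ℂ) r := by
    rw [mem_closedBall_zero_iff]
    have := norm_pEval_le_of_mem_polyHull hx (MvPolynomial.X 0) hr.le fun y hy => by
      simpa [pEval] using hy.1
    simpa [pEval] using this
  refine ⟨ha, ?_⟩
  have hq : ∀ y : ℂ × ℂ, pEval y (MvPolynomial.X 1 - MvPolynomial.C (F a)) = y.2 - F a :=
    fun y => by simp [pEval]
  have hp : ∀ y : ℂ × ℂ, pEval y ((MvPolynomial.X 0 ^ m - MvPolynomial.C (a ^ m)) *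
      (MvPolynomial.X 1 - MvPolynomial.C (F a))) = (y.1 ^ m - a ^ m) * (y.2 - F a) :=
    fun y => by simp [pEval]
  have hpos : ∀ z ∈ closedBall (0 : ℂ) r, z ^ m ≠ a ^ m →
      0 < ((z ^ m - a ^ m) * (F z - F a)).re := by
    intro z hz hne
    convert re_mul_conj_add_pos (hR z hz a ha hne) using 3
    simp only [hF, map_sub, map_pow]
    ring
  refine sub_eq_zero.1 ((hq (a, b)).symm.trans
    (pEval_eq_zero_of_mem_polyHull hX hx _ _ ((hp (a, b)).trans (by simp)) ?_ ?_))
  · rintro y ⟨hy, hyF⟩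
    rw [hp, hyF]
    by_cases h : y.1 ^ m = a ^ m
    · simp [h]
    · exact (hpos y.1 hy h).le
  · rintro y ⟨hy, hyF⟩ hne
    rw [hp, hyF]
    refine hpos y.1 hy fun h => hne ?_
    rw [hq, hyF]
    simp only [hF]
    rw [← map_pow, ← map_pow, h, eq_of_pow_eq_of_norm_sub_lt hm hRc hR hy ha h, sub_self]
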